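/- Let K = ℤ be the tropical semifield and let p = (p_i)_{i∈I} ∈ ℕ^I. Then the set 𝒰_{ℕ,p} of equivalence classes A contained in ℐ×ℕ^ν such that a_ν ≤ p_{i_ν} for every (i,a) ∈ A (i.e. the last entry of every representative is bounded by p evaluated at its last letter) is a finite set. -/

import Mathlib

open scoped BigOperators

namespace Lusztig

variable {I : Type*} [Fintype I] [DecidableEq I]

/-- A simply laced Cartan matrix: symmetric, positive definite, integer entries,
`2` on the diagonal and `0` or `-1` off the diagonal. -/
structure IsSimplyLacedCartan (A : Matrix I I ℤ) : Prop where
  symm : ∀ i j, A i j = A j i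
  posDef : ∀ x : I → ℤ, x ≠ 0 → 0 < ∑ i, ∑ j, x i * A i j * x j
  diag : ∀ i, A i i = 2
  offDiag : ∀ i j, i ≠ j → A i j = 0 ∨ A i j = -1

/-- The simple reflection `s_i` acting on `ℤ[I] = I → ℤ`, `s_i(j') = j' - a_{ij} i'`. -/
def sE (A : Matrix I I ℤ) (i : I) : Function.End (I → ℤ) :=
  fun x => x - (∑ j, A i j * x j) • Pi.single i 1

/-- The length of `w`: the least `n` such that `w` is a product of `n` simple
reflections (`∞` convention: `sInf ∅ = 0`). -/
noncomputable def len (A : Matrix I I ℤ) (w : Function.End (I → ℤ)) : ℕ :=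
  sInf {n | ∃ l : List I, l.length = n ∧ (l.map (sE A)).prod = w}

/-- `w₀` is the longest element of `W = ⟨s_i⟩` and `ν = |w₀|`. -/
structure IsLongest (A : Matrix I I ℤ) (w₀ : Function.End (I → ℤ)) (ν : ℕ) : Prop where
  mem : ∃ l : List I, (l.map (sE A)).prod = w₀
  len_eq : len A w₀ = ν
  longest : ∀ w : Function.End (I → ℤ),
    (∃ l : List I, (l.map (sE A)).prod = w) → len A w ≤ ν

/-- `ℐ`: the set of sequences `(i_1, …, i_ν)` with `s_{i_1} ⋯ s_{i_ν} = w₀`. -/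
def RedWord (A : Matrix I I ℤ) (w₀ : Function.End (I → ℤ)) (ν : ℕ) :
    Set (Fin ν → I) :=
  {f | ((List.ofFn f).map (sE A)).prod = w₀}

/-- The coefficient `r_{h,k}` defined by
`s_{i_1} ⋯ s_{i_{k-1}} (i_k') = Σ_h r_{h,k} h'` (here `k` is `0`-indexed). -/
def rCoef (A : Matrix I I ℤ) {ν : ℕ} (f : Fin ν → I) (h : I) (k : Fin ν) : ℤ :=
  ((List.ofFn fun m : Fin (k : ℕ) => sE A (f (Fin.castLE k.2.le m))).prod :
    Function.End (I → ℤ)) (Pi.single (f k) 1) h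

/-- `‖i,a‖_h = Π_k a_k^{r_{h,k}}`. -/
def normAt (A : Matrix I I ℤ) {ν : ℕ} {K : Type*} [CommGroup K]
    (f : Fin ν → I) (a : Fin ν → K) (h : I) : K :=
  ∏ k : Fin ν, a k ^ rCoef A f h k

section Semifield

variable {K : Type*} [CommGroup K] [AddCommSemigroup K]

/-- Adjacency of two pairs in `ℐ × K^ν`, for a semifield `K` (written
multiplicatively, with addition `+`). -/
def Adjacent (A : Matrix I I ℤ) (w₀ : Function.End (I → ℤ)) (ν : ℕ)
    (p q : (Fin ν → I) × (Fin ν → K)) : Prop :=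
  p.1 ∈ RedWord A w₀ ν ∧ q.1 ∈ RedWord A w₀ ν ∧
  ((∃ (l : ℕ) (h0 : l < ν) (h1 : l + 1 < ν) (h2 : l + 2 < ν),
      A (p.1 ⟨l, h0⟩) (p.1 ⟨l + 1, h1⟩) = -1 ∧
      p.1 ⟨l + 2, h2⟩ = p.1 ⟨l, h0⟩ ∧
      q.1 ⟨l, h0⟩ = p.1 ⟨l + 1, h1⟩ ∧ q.1 ⟨l + 1, h1⟩ = p.1 ⟨l, h0⟩ ∧
      q.1 ⟨l + 2, h2⟩ = p.1 ⟨l + 1, h1⟩ ∧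
      (∀ k : Fin ν, (k : ℕ) ≠ l → (k : ℕ) ≠ l + 1 → (k : ℕ) ≠ l + 2 →
        q.1 k = p.1 k ∧ q.2 k = p.2 k) ∧
      q.2 ⟨l, h0⟩ =
        p.2 ⟨l + 1, h1⟩ * p.2 ⟨l + 2, h2⟩ * (p.2 ⟨l, h0⟩ + p.2 ⟨l + 2, h2⟩)⁻¹ ∧
      q.2 ⟨l + 1, h1⟩ = p.2 ⟨l, h0⟩ + p.2 ⟨l + 2, h2⟩ ∧
      q.2 ⟨l + 2, h2⟩ =
        p.2 ⟨l, h0⟩ * p.2 ⟨l + 1, h1⟩ * (p.2 ⟨l, h0⟩ + p.2 ⟨l + 2, h2⟩)⁻¹) ∨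
   (∃ (l : ℕ) (h0 : l < ν) (h1 : l + 1 < ν),
      A (p.1 ⟨l, h0⟩) (p.1 ⟨l + 1, h1⟩) = 0 ∧
      q.1 ⟨l, h0⟩ = p.1 ⟨l + 1, h1⟩ ∧ q.1 ⟨l + 1, h1⟩ = p.1 ⟨l, h0⟩ ∧
      (∀ k : Fin ν, (k : ℕ) ≠ l → (k : ℕ) ≠ l + 1 →
        q.1 k = p.1 k ∧ q.2 k = p.2 k) ∧
      q.2 ⟨l, h0⟩ = p.2 ⟨l + 1, h1⟩ ∧ q.2 ⟨l + 1, h1⟩ = p.2 ⟨l, h0⟩))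

end Semifield

/-- Adjacency of two pairs in `ℐ × ℤ^ν` for the tropical semifield `ℤ`
(sum = `min`, product = `+`). -/
def TAdjacent (A : Matrix I I ℤ) (w₀ : Function.End (I → ℤ)) (ν : ℕ)
    (p q : (Fin ν → I) × (Fin ν → ℤ)) : Prop :=
  p.1 ∈ RedWord A w₀ ν ∧ q.1 ∈ RedWord A w₀ ν ∧
  ((∃ (l : ℕ) (h0 : l < ν) (h1 : l + 1 < ν) (h2 : l + 2 < ν),
      A (p.1 ⟨l, h0⟩) (p.1 ⟨l + 1, h1⟩) = -1 ∧
      p.1 ⟨l + 2, h2⟩ = p.1 ⟨l, h0⟩ ∧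
      q.1 ⟨l, h0⟩ = p.1 ⟨l + 1, h1⟩ ∧ q.1 ⟨l + 1, h1⟩ = p.1 ⟨l, h0⟩ ∧
      q.1 ⟨l + 2, h2⟩ = p.1 ⟨l + 1, h1⟩ ∧
      (∀ k : Fin ν, (k : ℕ) ≠ l → (k : ℕ) ≠ l + 1 → (k : ℕ) ≠ l + 2 →
        q.1 k = p.1 k ∧ q.2 k = p.2 k) ∧
      q.2 ⟨l, h0⟩ =
        p.2 ⟨l + 1, h1⟩ + p.2 ⟨l + 2, h2⟩ - min (p.2 ⟨l, h0⟩) (p.2 ⟨l + 2, h2⟩) ∧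
      q.2 ⟨l + 1, h1⟩ = min (p.2 ⟨l, h0⟩) (p.2 ⟨l + 2, h2⟩) ∧
      q.2 ⟨l + 2, h2⟩ =
        p.2 ⟨l, h0⟩ + p.2 ⟨l + 1, h1⟩ - min (p.2 ⟨l, h0⟩) (p.2 ⟨l + 2, h2⟩)) ∨
   (∃ (l : ℕ) (h0 : l < ν) (h1 : l + 1 < ν),
      A (p.1 ⟨l, h0⟩) (p.1 ⟨l + 1, h1⟩) = 0 ∧
      q.1 ⟨l, h0⟩ = p.1 ⟨l + 1, h1⟩ ∧ q.1 ⟨l + 1, h1⟩ = p.1 ⟨l, h0⟩ ∧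
      (∀ k : Fin ν, (k : ℕ) ≠ l → (k : ℕ) ≠ l + 1 →
        q.1 k = p.1 k ∧ q.2 k = p.2 k) ∧
      q.2 ⟨l, h0⟩ = p.2 ⟨l + 1, h1⟩ ∧ q.2 ⟨l + 1, h1⟩ = p.2 ⟨l, h0⟩))

section FinitenessProof

open Relation

/-- The simple root indexed by `i`. -/
def simpleRoot (i : I) : I → ℤ := Pi.single i 1

/-- The bilinear form of a matrix. -/
def form (A : Matrix I I ℤ) (x y : I → ℤ) : ℤ := ∑ i, ∑ j, x i * A i j * y j

omit [DecidableEq I] in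
theorem form_sub_left (A : Matrix I I ℤ) (x y z : I → ℤ) :
    form A (x - y) z = form A x z - form A y z := by
  simp [form, sub_mul, Finset.sum_sub_distrib]

omit [DecidableEq I] in
theorem form_sub_right (A : Matrix I I ℤ) (x y z : I → ℤ) :
    form A x (y - z) = form A x y - form A x z := by
  simp [form, mul_sub, Finset.sum_sub_distrib]

omit [DecidableEq I] in
theorem form_smul_left (A : Matrix I I ℤ) (c : ℤ) (x y : I → ℤ) :
    form A (c • x) y = c * form A x y := by
  simp [form, Finset.mul_sum, mul_assoc]

omit [DecidableEq I] in
theorem form_smul_right (A : Matrix I I ℤ) (c : ℤ) (x y : I → ℤ) :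
    form A x (c • y) = c * form A x y := by
  simp only [form, Finset.mul_sum, Pi.smul_apply, smul_eq_mul]
  exact Finset.sum_congr rfl fun i _ => Finset.sum_congr rfl fun j _ => by ring

theorem form_simpleRoot_left (A : Matrix I I ℤ) (i : I) (x : I → ℤ) :
    form A (simpleRoot i) x = ∑ j, A i j * x j := by
  unfold form simpleRoot
  rw [Finset.sum_eq_single i]
  · simp
  · intro b _ hb
    simp [hb]
  · simp

theorem form_simpleRoot (A : Matrix I I ℤ) (i j : I) :
    form A (simpleRoot i) (simpleRoot j) = A i j := by
  rw [form_simpleRoot_left]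
  simp [simpleRoot, Pi.single_apply]

/-- The simple reflection `s_i` as a linear map. -/
def simpleRefl (A : Matrix I I ℤ) (i : I) : Module.End ℤ (I → ℤ) where
  toFun x := x - form A (simpleRoot i) x • simpleRoot i
  map_add' x y := by
    simp only [form_simpleRoot_left, Pi.add_apply, mul_add, Finset.sum_add_distrib, add_smul]
    abel
  map_smul' c x := by
    simp only [form_smul_right, RingHom.id_apply, smul_sub, mul_smul]

theorem simpleRefl_apply (A : Matrix I I ℤ) (i : I) (x : I → ℤ) :
    simpleRefl A i x = x - form A (simpleRoot i) x • simpleRoot i := rfl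

theorem simpleRefl_simpleRoot (A : Matrix I I ℤ) (i j : I) :
    simpleRefl A i (simpleRoot j) = simpleRoot j - A i j • simpleRoot i := by
  rw [simpleRefl_apply, form_simpleRoot]

/-- The product of the simple reflections along a word. -/
def wordProd (A : Matrix I I ℤ) (L : List I) : Module.End ℤ (I → ℤ) :=
  (L.map (simpleRefl A)).prod

@[simp] theorem wordProd_nil (A : Matrix I I ℤ) : wordProd A [] = 1 := rfl

@[simp] theorem wordProd_cons (A : Matrix I I ℤ) (i : I) (L : List I) :
    wordProd A (i :: L) = simpleRefl A i * wordProd A L := by simp [wordProd]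

@[simp] theorem wordProd_append (A : Matrix I I ℤ) (L M : List I) :
    wordProd A (L ++ M) = wordProd A L * wordProd A M := by simp [wordProd]

theorem prod_map_sE (A : Matrix I I ℤ) (L : List I) :
    (L.map (sE A)).prod = (wordProd A L : (I → ℤ) → (I → ℤ)) := by
  induction L with
  | nil => rfl
  | cons i L ih =>
    rw [List.map_cons, List.prod_cons, ih, wordProd_cons]
    funext x
    change sE A i (wordProd A L x) = simpleRefl A i (wordProd A L x)
    rw [simpleRefl_apply, form_simpleRoot_left]
    rfl

theorem prod_map_sE_eq_iff (A : Matrix I I ℤ) (L M : List I) :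
    (L.map (sE A)).prod = (M.map (sE A)).prod ↔ wordProd A L = wordProd A M := by
  rw [prod_map_sE, prod_map_sE]
  exact DFunLike.coe_injective.eq_iff

/-- A word of minimal length among those with the same product. -/
def IsReducedWord (A : Matrix I I ℤ) (L : List I) : Prop :=
  ∀ M, wordProd A M = wordProd A L → L.length ≤ M.length

theorem IsReducedWord.left {A : Matrix I I ℤ} {P Q : List I} (h : IsReducedWord A (P ++ Q)) :
    IsReducedWord A P := fun M hM => by
  have := h (M ++ Q) (by simp [hM])
  simpa using this

theorem IsReducedWord.right {A : Matrix I I ℤ} {P Q : List I} (h : IsReducedWord A (P ++ Q)) :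
    IsReducedWord A Q := fun M hM => by
  have := h (P ++ M) (by simp [hM])
  simpa using this

omit [Fintype I] in
theorem simpleRoot_nonneg (i : I) : 0 ≤ simpleRoot i := by
  intro j
  by_cases h : j = i <;> simp [simpleRoot, h]

omit [Fintype I] in
theorem not_simpleRoot_nonpos (i : I) : ¬ simpleRoot i ≤ 0 := fun h => by
  have := h i
  simp [simpleRoot] at this

theorem apply_nonpos_of_nonneg (f : Module.End ℤ (I → ℤ)) (hf : ∀ i, f (simpleRoot i) ≤ 0)
    {x : I → ℤ} (hx : 0 ≤ x) : f x ≤ 0 := by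
  have h : x = ∑ i, x i • simpleRoot i := by
    funext j
    simp [simpleRoot, Finset.sum_apply, Pi.single_apply]
  rw [h, map_sum]
  refine Finset.sum_nonpos fun i _ => ?_
  rw [map_smul]
  exact smul_nonpos_of_nonneg_of_nonpos (hx i) (hf i)

namespace IsSimplyLacedCartan

variable {A : Matrix I I ℤ}

omit [DecidableEq I] in
theorem form_comm (hA : IsSimplyLacedCartan A) (x y : I → ℤ) : form A x y = form A y x := by
  unfold form
  rw [Finset.sum_comm]
  exact Finset.sum_congr rfl fun i _ => Finset.sum_congr rfl fun j _ => by
    rw [hA.symm j i]; ring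

omit [DecidableEq I] in
theorem even_form_self (hA : IsSimplyLacedCartan A) (x : I → ℤ) : Even (form A x x) := by
  rw [even_iff_two_dvd]
  refine (ZMod.intCast_zmod_eq_zero_iff_dvd _ 2).1 ?_
  unfold form
  rw [← Finset.sum_product']
  push_cast
  refine Finset.sum_involution (fun a _ => a.swap) ?_ ?_ (by simp) (by simp)
  · rintro ⟨i, j⟩ -
    simp only [Prod.swap, hA.symm j i]
    linear_combination (x i * A i j * x j : ZMod 2) * (CharTwo.two_eq_zero : (2 : ZMod 2) = 0)
  · rintro ⟨i, j⟩ - h h'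
    obtain rfl : j = i := (Prod.ext_iff.1 h').1
    refine h ?_
    simp only [hA.diag]
    linear_combination (x j * x j : ZMod 2) * (CharTwo.two_eq_zero : (2 : ZMod 2) = 0)

omit [DecidableEq I] in
theorem two_le_form_self (hA : IsSimplyLacedCartan A) {x : I → ℤ} (hx : x ≠ 0) :
    2 ≤ form A x x := by
  have h1 : 0 < form A x x := hA.posDef x hx
  obtain ⟨k, hk⟩ := hA.even_form_self x
  omega

omit [DecidableEq I] in
theorem form_posPart_negPart (hA : IsSimplyLacedCartan A) (x : I → ℤ) : form A x⁺ x⁻ ≤ 0 := by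
  unfold form
  refine Finset.sum_nonpos fun i _ => Finset.sum_nonpos fun j _ => ?_
  have h1 : 0 ≤ (x i)⁺ := posPart_nonneg _
  have h2 : 0 ≤ (x j)⁻ := negPart_nonneg _
  rw [Pi.posPart_apply, Pi.negPart_apply]
  by_cases hij : i = j
  · subst hij
    rcases le_total 0 (x i) with h | h
    · simp [negPart_eq_zero.2 h]
    · simp [posPart_eq_zero.2 h]
  · rcases hA.offDiag i j hij with h | h <;> rw [h]
    · simp
    · nlinarith [mul_nonneg h1 h2]

omit [DecidableEq I] in
/-- A root (a vector of norm two) is either positive or negative. -/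
theorem nonneg_or_nonpos (hA : IsSimplyLacedCartan A) {x : I → ℤ} (hx : form A x x = 2) :
    0 ≤ x ∨ x ≤ 0 := by
  by_contra! h
  have hp : x⁺ ≠ 0 := fun h0 => h.2 (posPart_eq_zero.1 h0)
  have hn : x⁻ ≠ 0 := fun h0 => h.1 (negPart_eq_zero.1 h0)
  have h1 := hA.two_le_form_self hp
  have h2 := hA.two_le_form_self hn
  have h3 := hA.form_posPart_negPart x
  have h4 : form A x x = form A (x⁺ - x⁻) (x⁺ - x⁻) := by rw [posPart_sub_negPart]
  rw [form_sub_left, form_sub_right, form_sub_right, hA.form_comm x⁻ x⁺] at h4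
  omega

theorem form_simpleRefl (hA : IsSimplyLacedCartan A) (i : I) (x y : I → ℤ) :
    form A (simpleRefl A i x) (simpleRefl A i y) = form A x y := by
  simp only [simpleRefl_apply, form_sub_left, form_sub_right, form_smul_left, form_smul_right,
    form_simpleRoot, hA.diag, hA.form_comm x (simpleRoot i)]
  ring

theorem form_wordProd (hA : IsSimplyLacedCartan A) (L : List I) (x y : I → ℤ) :
    form A (wordProd A L x) (wordProd A L y) = form A x y := by
  induction L with
  | nil => rfl
  | cons i L ih => rw [wordProd_cons, Module.End.mul_apply, Module.End.mul_apply,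
      hA.form_simpleRefl, ih]

theorem wordProd_simpleRoot_nonneg_or_nonpos (hA : IsSimplyLacedCartan A) (L : List I) (i : I) :
    0 ≤ wordProd A L (simpleRoot i) ∨ wordProd A L (simpleRoot i) ≤ 0 :=
  hA.nonneg_or_nonpos (by rw [hA.form_wordProd, form_simpleRoot, hA.diag])

theorem simpleRefl_simpleRoot_self (hA : IsSimplyLacedCartan A) (i : I) :
    simpleRefl A i (simpleRoot i) = -simpleRoot i := by
  rw [simpleRefl_simpleRoot, hA.diag]
  module

theorem simpleRefl_mul_self (hA : IsSimplyLacedCartan A) (i : I) :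
    simpleRefl A i * simpleRefl A i = 1 := by
  refine LinearMap.ext fun x => ?_
  rw [Module.End.mul_apply, simpleRefl_apply A i x, map_sub, map_smul,
    hA.simpleRefl_simpleRoot_self, simpleRefl_apply, Module.End.one_apply]
  module

theorem simpleRefl_mul_cancel (hA : IsSimplyLacedCartan A) (i : I)
    (f : Module.End ℤ (I → ℤ)) : simpleRefl A i * (simpleRefl A i * f) = f := by
  rw [← mul_assoc, hA.simpleRefl_mul_self, one_mul]

theorem wordProd_mul_wordProd_reverse (hA : IsSimplyLacedCartan A) (L : List I) :
    wordProd A L * wordProd A L.reverse = 1 := by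
  induction L with
  | nil => simp
  | cons i L ih =>
    rw [List.reverse_cons, wordProd_append, wordProd_cons, mul_assoc,
      ← mul_assoc (wordProd A L), ih]
    simp [hA.simpleRefl_mul_self]

theorem wordProd_reverse_mul_wordProd (hA : IsSimplyLacedCartan A) (L : List I) :
    wordProd A L.reverse * wordProd A L = 1 := by
  simpa using hA.wordProd_mul_wordProd_reverse L.reverse

theorem isReducedWord_reverse (hA : IsSimplyLacedCartan A) {L : List I}
    (h : IsReducedWord A L) : IsReducedWord A L.reverse := fun M hM => by
  have key : wordProd A M.reverse = wordProd A L := by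
    calc wordProd A M.reverse
        = wordProd A M.reverse * (wordProd A L.reverse * wordProd A L) := by
          rw [hA.wordProd_reverse_mul_wordProd, mul_one]
      _ = wordProd A L := by
          rw [← hM, ← mul_assoc, hA.wordProd_reverse_mul_wordProd, one_mul]
  simpa using h M.reverse key

theorem simpleRefl_mul_wordProd (hA : IsSimplyLacedCartan A) {L : List I} {i m : I}
    (h : wordProd A L (simpleRoot m) = simpleRoot i) :
    simpleRefl A i * wordProd A L = wordProd A L * simpleRefl A m := by
  refine LinearMap.ext fun x => ?_
  rw [Module.End.mul_apply, Module.End.mul_apply, simpleRefl_apply, simpleRefl_apply, map_sub,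
    map_smul, h, ← h, hA.form_wordProd]

theorem eq_simpleRoot (hA : IsSimplyLacedCartan A) {i : I} {x : I → ℤ} (hx : form A x x = 2)
    (h0 : 0 ≤ x) (h1 : simpleRefl A i x ≤ 0) : x = simpleRoot i := by
  have hx' : x = x i • simpleRoot i := by
    funext j
    by_cases hj : j = i
    · subst hj
      simp [simpleRoot]
    · have h2 := h1 j
      have h3 := h0 j
      simp only [simpleRefl_apply, simpleRoot, Pi.sub_apply, Pi.smul_apply, Pi.zero_apply,
        Pi.single_eq_of_ne hj, smul_zero, sub_zero] at h2 h3 ⊢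
      exact le_antisymm h2 h3
  rw [hx', form_smul_left, form_smul_right, form_simpleRoot, hA.diag] at hx
  have h4 : 0 ≤ x i := h0 i
  have h5 : x i = 1 := by nlinarith
  rw [hx', h5, one_smul]

theorem exists_split (hA : IsSimplyLacedCartan A) {m : I} :
    ∀ {L : List I}, wordProd A L (simpleRoot m) ≤ 0 →
      ∃ P i Q, L = P ++ i :: Q ∧ wordProd A Q (simpleRoot m) = simpleRoot i
  | [], h => absurd h (not_simpleRoot_nonpos m)
  | i :: L, h => by
    rcases hA.wordProd_simpleRoot_nonneg_or_nonpos L m with h' | h'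
    · refine ⟨[], i, L, rfl, hA.eq_simpleRoot ?_ h' ?_⟩
      · rw [hA.form_wordProd, form_simpleRoot, hA.diag]
      · simpa using h
    · obtain ⟨P, k, Q, rfl, hQ⟩ := hA.exists_split h'
      exact ⟨i :: P, k, Q, rfl, hQ⟩

/-- The exchange condition. -/
theorem exists_exchange (hA : IsSimplyLacedCartan A) {m : I} {L : List I}
    (h : wordProd A L (simpleRoot m) ≤ 0) :
    ∃ M, M.length + 1 = L.length ∧ wordProd A M = wordProd A L * simpleRefl A m := by
  obtain ⟨P, i, Q, rfl, hQ⟩ := hA.exists_split h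
  refine ⟨P ++ Q, by simp; omega, ?_⟩
  rw [wordProd_append, wordProd_append, wordProd_cons, mul_assoc, mul_assoc,
    ← hA.simpleRefl_mul_wordProd hQ, hA.simpleRefl_mul_cancel]

theorem nonneg_of_isReducedWord (hA : IsSimplyLacedCartan A) {P : List I} {m : I}
    (h : IsReducedWord A (P ++ [m])) : 0 ≤ wordProd A P (simpleRoot m) := by
  refine (hA.wordProd_simpleRoot_nonneg_or_nonpos P m).resolve_right fun h' => ?_
  obtain ⟨M, hM, hM'⟩ := hA.exists_exchange h'
  have := h M (by simp [hM'])
  simp at this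
  omega

theorem isReducedWord_concat (hA : IsSimplyLacedCartan A) {P : List I} {m : I}
    (hP : IsReducedWord A P) (h : 0 ≤ wordProd A P (simpleRoot m)) :
    IsReducedWord A (P ++ [m]) := fun L hL => by
  have h1 : wordProd A L (simpleRoot m) ≤ 0 := by
    rw [hL, wordProd_append, Module.End.mul_apply, wordProd_cons, wordProd_nil, mul_one,
      hA.simpleRefl_simpleRoot_self, map_neg]
    exact neg_nonpos.2 h
  obtain ⟨M, hM, hM'⟩ := hA.exists_exchange h1
  have := hP M (by rw [hM', hL, wordProd_append, mul_assoc]; simp [hA.simpleRefl_mul_self])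
  simp
  omega

theorem simpleRefl_comm (hA : IsSimplyLacedCartan A) {i j : I} (h : A i j = 0) :
    simpleRefl A i * simpleRefl A j = simpleRefl A j * simpleRefl A i := by
  have := hA.simpleRefl_mul_wordProd (L := [i]) (i := j) (m := j)
    (by simp [simpleRefl_simpleRoot, h])
  simpa using this.symm

theorem simpleRefl_braid (hA : IsSimplyLacedCartan A) {i j : I} (h : A i j = -1) :
    simpleRefl A i * (simpleRefl A j * simpleRefl A i) =
      simpleRefl A j * (simpleRefl A i * simpleRefl A j) := by
  have h' : A j i = -1 := by rw [hA.symm, h]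
  have := hA.simpleRefl_mul_wordProd (L := [i, j]) (i := j) (m := i) (by
    simp only [wordProd_cons, wordProd_nil, mul_one, Module.End.mul_apply, simpleRefl_simpleRoot,
      map_sub, map_smul, h, h', hA.diag]
    module)
  simpa [mul_assoc] using this.symm

end IsSimplyLacedCartan

/-- The tropical braid moves on words whose letters carry integer labels. -/
inductive Move (A : Matrix I I ℤ) : List (I × ℤ) → List (I × ℤ) → Prop
  | braid (P Q : List (I × ℤ)) (i j : I) (x y z : ℤ) (h : A i j = -1) :
      Move A (P ++ (i, x) :: (j, y) :: (i, z) :: Q)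
        (P ++ (j, y + z - min x z) :: (i, min x z) :: (j, x + y - min x z) :: Q)
  | comm (P Q : List (I × ℤ)) (i j : I) (x y : ℤ) (h : A i j = 0) :
      Move A (P ++ (i, x) :: (j, y) :: Q) (P ++ (j, y) :: (i, x) :: Q)

namespace Move

variable {A : Matrix I I ℤ} {L M : List (I × ℤ)}

omit [Fintype I] [DecidableEq I] in
theorem append_left (R : List (I × ℤ)) (h : Move A L M) : Move A (R ++ L) (R ++ M) := by
  cases h with
  | braid P Q i j x y z h => simpa using braid (R ++ P) Q i j x y z h
  | comm P Q i j x y h => simpa using comm (R ++ P) Q i j x y h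

omit [Fintype I] [DecidableEq I] in
theorem append_right (R : List (I × ℤ)) (h : Move A L M) : Move A (L ++ R) (M ++ R) := by
  cases h with
  | braid P Q i j x y z h => simpa using braid P (Q ++ R) i j x y z h
  | comm P Q i j x y h => simpa using comm P (Q ++ R) i j x y h

omit [Fintype I] [DecidableEq I] in
theorem length_eq (h : Move A L M) : M.length = L.length := by
  cases h <;> simp

omit [DecidableEq I] in
theorem reverse (hA : IsSimplyLacedCartan A) (h : Move A L M) : Move A L.reverse M.reverse := by
  cases h with
  | braid P Q i j x y z h =>
    have := braid Q.reverse P.reverse i j z y x h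
    rw [min_comm z x, add_comm y x, add_comm z y] at this
    simpa using this
  | comm P Q i j x y h =>
    simpa using comm Q.reverse P.reverse j i y x (by rw [hA.symm, h])

theorem wordProd_eq (hA : IsSimplyLacedCartan A) (h : Move A L M) :
    wordProd A (M.map Prod.fst) = wordProd A (L.map Prod.fst) := by
  cases h with
  | braid P Q i j x y z h =>
    have := congrArg (· * wordProd A (Q.map Prod.fst)) (hA.simpleRefl_braid h)
    simp only [mul_assoc] at this
    simp [this]
  | comm P Q i j x y h =>
    have := congrArg (· * wordProd A (Q.map Prod.fst)) (hA.simpleRefl_comm h)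
    simp only [mul_assoc] at this
    simp [this]

end Move

/-- Reachability by tropical braid moves. -/
abbrev Moves (A : Matrix I I ℤ) : List (I × ℤ) → List (I × ℤ) → Prop := ReflTransGen (Move A)

namespace Moves

variable {A : Matrix I I ℤ} {L M : List (I × ℤ)}

omit [Fintype I] [DecidableEq I] in
theorem append_left (R : List (I × ℤ)) (h : Moves A L M) : Moves A (R ++ L) (R ++ M) :=
  h.lift (R ++ ·) fun _ _ => Move.append_left R

omit [Fintype I] [DecidableEq I] in
theorem append_right (R : List (I × ℤ)) (h : Moves A L M) : Moves A (L ++ R) (M ++ R) :=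
  h.lift (· ++ R) fun _ _ => Move.append_right R

omit [DecidableEq I] in
theorem reverse (hA : IsSimplyLacedCartan A) (h : Moves A L M) :
    Moves A L.reverse M.reverse :=
  h.lift List.reverse fun _ _ => Move.reverse hA

omit [Fintype I] [DecidableEq I] in
theorem length_eq (h : Moves A L M) : M.length = L.length := by
  induction h with
  | refl => rfl
  | tail _ h ih => rw [h.length_eq, ih]

theorem wordProd_eq (hA : IsSimplyLacedCartan A) (h : Moves A L M) :
    wordProd A (M.map Prod.fst) = wordProd A (L.map Prod.fst) := by
  induction h with
  | refl => rfl
  | tail _ h ih => rw [h.wordProd_eq hA, ih]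

theorem isReducedWord (hA : IsSimplyLacedCartan A) (h : Moves A L M)
    (hL : IsReducedWord A (L.map Prod.fst)) : IsReducedWord A (M.map Prod.fst) := fun N hN => by
  have := hL N (hN.trans (h.wordProd_eq hA))
  simpa [h.length_eq] using this

end Moves

namespace IsSimplyLacedCartan

variable {A : Matrix I I ℤ}

/-- A reduced word with right descent `j` can be moved to one ending in `j`. -/
theorem exists_moves_concat (hA : IsSimplyLacedCartan A) (n : ℕ) :
    ∀ (L : List (I × ℤ)) (j : I), L.length = n → IsReducedWord A (L.map Prod.fst) →
      wordProd A (L.map Prod.fst) (simpleRoot j) ≤ 0 →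
      ∃ M x, Moves A L (M ++ [(j, x)]) := by
  induction n using Nat.strong_induction_on with
  | _ n ih =>
  intro L j hn hL hj
  rcases List.eq_nil_or_concat L with rfl | ⟨Y, ⟨m, x⟩, rfl⟩
  · exact absurd hj (not_simpleRoot_nonpos j)
  rw [List.concat_eq_append] at *
  by_cases hmj : m = j
  · subst hmj
    exact ⟨Y, x, .refl⟩
  simp only [List.length_append, List.length_singleton] at hn
  have hmap : (Y ++ [(m, x)]).map Prod.fst = Y.map Prod.fst ++ [m] := by simp
  rw [hmap] at hL hj
  have hYm := hA.nonneg_of_isReducedWord hL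
  rw [wordProd_append, wordProd_cons, wordProd_nil, mul_one, Module.End.mul_apply,
    simpleRefl_simpleRoot] at hj
  rcases hA.offDiag m j hmj with h | h
  · rw [h, zero_smul, sub_zero] at hj
    obtain ⟨Y', y, hY'⟩ := ih Y.length (by omega) Y j rfl hL.left hj
    refine ⟨Y' ++ [(m, x)], y, (hY'.append_right _).tail ?_⟩
    simpa using Move.comm Y' [] j m y x (by rw [hA.symm, h])
  · have h' : A j m = -1 := by rw [hA.symm, h]
    rw [h, neg_smul, one_smul, sub_neg_eq_add, map_add] at hj
    have hYj : wordProd A (Y.map Prod.fst) (simpleRoot j) ≤ 0 :=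
      (le_add_of_nonneg_right hYm).trans hj
    obtain ⟨Y', y, hY'⟩ := ih Y.length (by omega) Y j rfl hL.left hYj
    have hred := hY'.isReducedWord hA hL.left
    have hlen := hY'.length_eq
    have hprod := hY'.wordProd_eq hA
    simp only [List.map_append, List.map_cons, List.map_nil, List.length_append,
      List.length_singleton] at hred hlen hprod
    have hY'm : wordProd A (Y'.map Prod.fst) (simpleRoot m) ≤ 0 := by
      rw [← map_add, ← hprod, wordProd_append, wordProd_cons, wordProd_nil, mul_one,
        Module.End.mul_apply, map_add, hA.simpleRefl_simpleRoot_self, simpleRefl_simpleRoot,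
        h', neg_smul, one_smul] at hj
      simpa using hj
    obtain ⟨Y'', z, hY''⟩ := ih Y'.length (by omega) Y' m rfl hred.left hY'm
    refine ⟨Y'' ++ [(j, y + x - min z x), (m, min z x)], z + y - min z x,
      ((hY'.append_right _).trans ((hY''.append_right _).append_right _)).tail ?_⟩
    simpa using Move.braid Y'' [] m j z y x h

theorem exists_moves_cons (hA : IsSimplyLacedCartan A) {L : List (I × ℤ)} {j : I}
    (hL : IsReducedWord A (L.map Prod.fst))
    (hj : wordProd A (L.map Prod.fst).reverse (simpleRoot j) ≤ 0) :
    ∃ M x, Moves A L ((j, x) :: M) := by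
  obtain ⟨M, x, h⟩ := hA.exists_moves_concat _ L.reverse j rfl
    (by rw [List.map_reverse]; exact hA.isReducedWord_reverse hL)
    (by rw [List.map_reverse]; exact hj)
  exact ⟨M.reverse, x, by simpa using h.reverse hA⟩

/-- If the last labels of a family of labelled reduced words of `w₀` closed under moves are
bounded, then so are all the labels. -/
theorem label_le (hA : IsSimplyLacedCartan A) {w : Module.End ℤ (I → ℤ)}
    (hw : ∀ i, w (simpleRoot i) ≤ 0) {T : List (I × ℤ) → Prop} {B : ℤ} (hB : 0 ≤ B)
    (hmove : ∀ L M, T L → Move A L M → T M)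
    (hred : ∀ L, T L → IsReducedWord A (L.map Prod.fst))
    (hprod : ∀ L, T L → wordProd A (L.map Prod.fst) = w)
    (hnonneg : ∀ L, T L → ∀ a ∈ L, 0 ≤ a.2)
    (hlast : ∀ L a, T (L ++ [a]) → a.2 ≤ B) (n : ℕ) :
    ∀ P a S, S.length ≤ n → T (P ++ a :: S) → a.2 ≤ 2 ^ n * B := by
  have hmoves : ∀ L M, T L → Moves A L M → T M := fun L M hL h => by
    induction h with
    | refl => exact hL
    | tail _ h ih => exact hmove _ _ ih h
  induction n with
  | zero =>
    intro P a S hS hT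
    obtain rfl : S = [] := List.length_eq_zero_iff.1 (by omega)
    simpa using hlast P a hT
  | succ n ih =>
    rintro P ⟨i, x⟩ S hS hT
    set C : ℤ := 2 ^ n * B with hC
    have hC0 : 0 ≤ C := by positivity
    have hC2 : 2 ^ (n + 1) * B = C + C := by rw [hC]; ring
    rw [hC2]
    change x ≤ C + C
    rcases S with _ | ⟨⟨j, y⟩, S⟩
    · have : x ≤ C := ih P (i, x) [] (by simp) hT
      omega
    simp only [List.length_cons, Nat.add_le_add_iff_right] at hS
    have hRed := hred _ hT
    simp only [List.map_append, List.map_cons] at hRed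
    have hRed' := hRed.right
    have hij : i ≠ j := by
      rintro rfl
      have := hRed' (S.map Prod.fst) (by simp [hA.simpleRefl_mul_cancel])
      simp at this
    rcases hA.offDiag i j hij with h | h
    · have := ih (P ++ [(j, y)]) (i, x) S hS
        (by simpa using hmove _ _ hT (Move.comm P S i j x y h))
      change x ≤ C at this
      omega
    · rcases hA.wordProd_simpleRoot_nonneg_or_nonpos (S.map Prod.fst).reverse i with hS' | hS'
      · have h' : A j i = -1 := by rw [hA.symm, h]
        have hP : wordProd A (P.map Prod.fst) (simpleRoot j) ≤ 0 := by
          have e := hprod _ hT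
          simp only [List.map_append, List.map_cons, wordProd_append, wordProd_cons] at e
          have e1 : wordProd A (P.map Prod.fst) (simpleRoot j) =
              w (wordProd A (S.map Prod.fst).reverse (simpleRoot i)) := by
            rw [← e, ← Module.End.mul_apply _ (wordProd A (S.map Prod.fst).reverse), mul_assoc,
              mul_assoc, mul_assoc, hA.wordProd_mul_wordProd_reverse, mul_one,
              Module.End.mul_apply, Module.End.mul_apply, simpleRefl_simpleRoot, h', map_sub,
              map_smul, hA.simpleRefl_simpleRoot_self, simpleRefl_simpleRoot, h]
            congr 1
            module
          rw [e1]
          exact apply_nonpos_of_nonneg w hw hS'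
        obtain ⟨P', u, hP'⟩ := hA.exists_moves_concat _ P j rfl hRed.left hP
        have hT' := hmoves _ _ hT (hP'.append_right _)
        rw [List.append_assoc, List.singleton_append] at hT'
        have := ih (P' ++ [(i, x + y - min u y), (j, min u y)]) (i, u + x - min u y) S hS
          (by simpa using hmove _ _ hT' (Move.braid P' S j i u x y h'))
        change u + x - min u y ≤ C at this
        have := min_le_left u y
        omega
      · obtain ⟨S', z, hS''⟩ := hA.exists_moves_cons
          (hRed'.right (P := [i, j])) hS'
        have hlen := hS''.length_eq
        simp only [List.length_cons] at hlen
        have hT' : T (P ++ (i, x) :: (j, y) :: (i, z) :: S') :=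
          hmoves _ _ hT (by simpa using hS''.append_left (P ++ [(i, x), (j, y)]))
        have hz := ih (P ++ [(i, x), (j, y)]) (i, z) S' (by omega) (by simpa using hT')
        have hxyz := ih (P ++ [(j, y + z - min x z), (i, min x z)]) (j, x + y - min x z) S'
          (by omega) (by simpa using hmove _ _ hT' (Move.braid P S' i j x y z h))
        have hy : 0 ≤ y := hnonneg _ hT (j, y) (by simp)
        change z ≤ C at hz
        change x + y - min x z ≤ C at hxyz
        have := min_le_right x z
        omega

end IsSimplyLacedCartan

/-- The labelled word attached to a pair of functions. -/
def labelledWord {ν : ℕ} (q : (Fin ν → I) × (Fin ν → ℤ)) : List (I × ℤ) :=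
  List.ofFn fun k => (q.1 k, q.2 k)

omit [Fintype I] [DecidableEq I] in
theorem map_fst_labelledWord {ν : ℕ} (q : (Fin ν → I) × (Fin ν → ℤ)) :
    (labelledWord q).map Prod.fst = List.ofFn q.1 := by
  rw [labelledWord, List.map_ofFn]
  rfl

omit [Fintype I] [DecidableEq I] in
theorem getElem?_labelledWord {ν : ℕ} (q : (Fin ν → I) × (Fin ν → ℤ)) {k : ℕ} (hk : k < ν) :
    (labelledWord q)[k]? = some (q.1 ⟨k, hk⟩, q.2 ⟨k, hk⟩) := by
  simp [labelledWord, hk]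

omit [Fintype I] [DecidableEq I] in
theorem exists_labelledWord_eq {ν : ℕ} {L : List (I × ℤ)} (hL : L.length = ν) :
    ∃ q : (Fin ν → I) × (Fin ν → ℤ), labelledWord q = L := by
  subst hL
  exact ⟨(fun k => L[k].1, fun k => L[k].2), by simp [labelledWord]⟩

theorem tAdjacent_of_move {A : Matrix I I ℤ} (hA : IsSimplyLacedCartan A)
    {w₀ : Function.End (I → ℤ)} {ν : ℕ} {q r : (Fin ν → I) × (Fin ν → ℤ)}
    (hq : q.1 ∈ RedWord A w₀ ν) (h : Move A (labelledWord q) (labelledWord r)) :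
    TAdjacent A w₀ ν q r := by
  have hr : r.1 ∈ RedWord A w₀ ν := by
    have := h.wordProd_eq hA
    rw [map_fst_labelledWord, map_fst_labelledWord, ← prod_map_sE_eq_iff] at this
    exact this.trans hq
  refine ⟨hq, hr, ?_⟩
  have hq' := fun k (hk : k < ν) => getElem?_labelledWord q hk
  have hr' := fun k (hk : k < ν) => getElem?_labelledWord r hk
  have hlen : (labelledWord q).length = ν := by simp [labelledWord]
  generalize labelledWord q = L at *
  generalize labelledWord r = M at *
  cases h with
  | braid P Q i j x y z h =>
    simp only [List.length_append, List.length_cons] at hlen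
    have h0 : P.length < ν := by omega
    have h1 : P.length + 1 < ν := by omega
    have h2 : P.length + 2 < ν := by omega
    have a0 := hq' _ h0
    have a1 := hq' _ h1
    have a2 := hq' _ h2
    have b0 := hr' _ h0
    have b1 := hr' _ h1
    have b2 := hr' _ h2
    simp at a0 a1 a2 b0 b1 b2
    refine Or.inl ⟨P.length, h0, h1, h2, by rw [← a0.1, ← a1.1, h], by rw [← a0.1, ← a2.1],
      by rw [← b0.1, ← a1.1], by rw [← b1.1, ← a0.1], by rw [← b2.1, ← a1.1], ?_,
      by rw [← b0.2, ← a0.2, ← a1.2, ← a2.2], by rw [← b1.2, ← a0.2, ← a2.2],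
      by rw [← b2.2, ← a0.2, ← a1.2, ← a2.2]⟩
    rintro ⟨k, hk⟩ n0 n1 n2
    have e : some (r.1 ⟨k, hk⟩, r.2 ⟨k, hk⟩) = some (q.1 ⟨k, hk⟩, q.2 ⟨k, hk⟩) := by
      rw [← hq' k hk, ← hr' k hk]
      rcases lt_or_ge k P.length with hk' | hk'
      · rw [List.getElem?_append_left hk', List.getElem?_append_left hk']
      · obtain ⟨t, rfl⟩ : ∃ t, k = P.length + (t + 3) := ⟨k - P.length - 3, by dsimp at *; omega⟩
        simp [List.getElem?_append]
    simpa using e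
  | comm P Q i j x y h =>
    simp only [List.length_append, List.length_cons] at hlen
    have h0 : P.length < ν := by omega
    have h1 : P.length + 1 < ν := by omega
    have a0 := hq' _ h0
    have a1 := hq' _ h1
    have b0 := hr' _ h0
    have b1 := hr' _ h1
    simp at a0 a1 b0 b1
    refine Or.inr ⟨P.length, h0, h1, by rw [← a0.1, ← a1.1, h],
      by rw [← b0.1, ← a1.1], by rw [← b1.1, ← a0.1], ?_,
      by rw [← b0.2, ← a1.2], by rw [← b1.2, ← a0.2]⟩
    rintro ⟨k, hk⟩ n0 n1
    have e : some (r.1 ⟨k, hk⟩, r.2 ⟨k, hk⟩) = some (q.1 ⟨k, hk⟩, q.2 ⟨k, hk⟩) := by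
      rw [← hq' k hk, ← hr' k hk]
      rcases lt_or_ge k P.length with hk' | hk'
      · rw [List.getElem?_append_left hk', List.getElem?_append_left hk']
      · obtain ⟨t, rfl⟩ : ∃ t, k = P.length + (t + 2) := ⟨k - P.length - 2, by dsimp at *; omega⟩
        simp [List.getElem?_append]
    simpa using e

theorem mem_redWord_of_eqvGen {A : Matrix I I ℤ} {w₀ : Function.End (I → ℤ)} {ν : ℕ}
    {p q : (Fin ν → I) × (Fin ν → ℤ)} (h : EqvGen (TAdjacent A w₀ ν) p q) :
    p.1 ∈ RedWord A w₀ ν ↔ q.1 ∈ RedWord A w₀ ν := by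
  induction h with
  | rel _ _ h => exact iff_of_true h.1 h.2.1
  | refl => exact Iff.rfl
  | symm _ _ _ ih => exact ih.symm
  | trans _ _ _ _ _ ih₁ ih₂ => exact ih₁.trans ih₂

theorem len_le_length (A : Matrix I I ℤ) {w : Function.End (I → ℤ)} {L : List I}
    (hL : (L.map (sE A)).prod = w) : len A w ≤ L.length :=
  Nat.sInf_le ⟨L, rfl, hL⟩

theorem IsReducedWord.len_eq {A : Matrix I I ℤ} {L : List I} (h : IsReducedWord A L) :
    len A (L.map (sE A)).prod = L.length := by
  refine le_antisymm (len_le_length A rfl) (le_csInf ⟨_, L, rfl, rfl⟩ ?_)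
  rintro _ ⟨M, rfl, hM⟩
  exact h M ((prod_map_sE_eq_iff A M L).1 hM)

theorem IsLongest.isReducedWord {A : Matrix I I ℤ} {w₀ : Function.End (I → ℤ)} {ν : ℕ}
    (hw : IsLongest A w₀ ν) {L : List I} (hL : (L.map (sE A)).prod = w₀) (hν : L.length = ν) :
    IsReducedWord A L := fun M hM => by
  rw [hν, ← hw.len_eq]
  exact len_le_length A (((prod_map_sE_eq_iff A M L).2 hM).trans hL)

theorem IsLongest.apply_simpleRoot_nonpos {A : Matrix I I ℤ} (hA : IsSimplyLacedCartan A)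
    {w₀ : Function.End (I → ℤ)} {ν : ℕ} (hw : IsLongest A w₀ ν) {L : List I}
    (hL : (L.map (sE A)).prod = w₀) (hν : L.length = ν) (i : I) :
    wordProd A L (simpleRoot i) ≤ 0 := by
  refine (hA.wordProd_simpleRoot_nonneg_or_nonpos L i).resolve_left fun h => ?_
  have h1 := (hA.isReducedWord_concat (hw.isReducedWord hL hν) h).len_eq
  have h2 := hw.longest _ ⟨L ++ [i], rfl⟩
  rw [h1, List.length_append, List.length_singleton] at h2
  omega

end FinitenessProof

/-- finiteness of `𝒰_{ℕ,p}`: for `p ∈ ℕ^I`, the collection of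
equivalence classes all of whose representatives have nonnegative entries with
last entry bounded by `p` evaluated at the last letter is finite. -/
theorem UNp_finite (A : Matrix I I ℤ) (hA : IsSimplyLacedCartan A)
    (w₀ : Function.End (I → ℤ)) (ν : ℕ) (hw : IsLongest A w₀ ν) (pv : I → ℕ) :
    {C : Set ((Fin ν → I) × (Fin ν → ℤ)) |
      ∃ p, p.1 ∈ RedWord A w₀ ν ∧
        (∀ q, Relation.EqvGen (TAdjacent A w₀ ν) p q →
          (∀ k : Fin ν, 0 ≤ q.2 k) ∧
          (∀ k : Fin ν, (k : ℕ) = ν - 1 → q.2 k ≤ (pv (q.1 k) : ℤ))) ∧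
        C = {q | Relation.EqvGen (TAdjacent A w₀ ν) p q}}.Finite := by
  set N : ℤ := 2 ^ ν * ∑ i, (pv i : ℤ) with hN
  have hfin : {p : (Fin ν → I) × (Fin ν → ℤ) | ∀ k, p.2 k ∈ Set.Icc 0 N}.Finite := by
    refine (Set.finite_univ.prod (Set.Finite.pi' fun _ : Fin ν => Set.finite_Icc 0 N)).subset ?_
    exact fun p hp => ⟨Set.mem_univ _, hp⟩
  refine (hfin.image fun p => {q | Relation.EqvGen (TAdjacent A w₀ ν) p q}).subset ?_
  rintro C ⟨p, hp, hbound, rfl⟩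
  refine ⟨p, fun k => ⟨(hbound p (.refl p)).1 k, ?_⟩, rfl⟩
  let T : List (I × ℤ) → Prop := fun L =>
    ∃ q, Relation.EqvGen (TAdjacent A w₀ ν) p q ∧ labelledWord q = L
  have hmem : ∀ q, Relation.EqvGen (TAdjacent A w₀ ν) p q →
      (((labelledWord q).map Prod.fst).map (sE A)).prod = w₀ := fun q hq => by
    rw [map_fst_labelledWord]
    exact (mem_redWord_of_eqvGen hq).1 hp
  have hlen : ∀ q : (Fin ν → I) × (Fin ν → ℤ), (labelledWord q).length = ν := fun q => by
    simp [labelledWord]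
  have key := hA.label_le (w := wordProd A ((labelledWord p).map Prod.fst)) (T := T)
    (B := ∑ i, (pv i : ℤ))
    (hw.apply_simpleRoot_nonpos hA (hmem p (.refl p)) (by simp [hlen]))
    (Finset.sum_nonneg fun i _ => Int.natCast_nonneg _)
    (by
      rintro _ M ⟨q, hq, rfl⟩ hM
      obtain ⟨r, rfl⟩ := exists_labelledWord_eq (hM.length_eq.trans (hlen q))
      exact ⟨r, hq.trans _ _ _ (.rel _ _
        (tAdjacent_of_move hA ((mem_redWord_of_eqvGen hq).1 hp) hM)), rfl⟩)
    (by
      rintro _ ⟨q, hq, rfl⟩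
      exact hw.isReducedWord (hmem q hq) (by simp [hlen]))
    (by
      rintro _ ⟨q, hq, rfl⟩
      exact (prod_map_sE_eq_iff A _ _).1 ((hmem q hq).trans (hmem p (.refl p)).symm))
    (by
      rintro _ ⟨q, hq, rfl⟩ a ha
      obtain ⟨k, rfl⟩ := List.mem_ofFn.1 ha
      exact (hbound q hq).1 k)
    (by
      rintro L a ⟨q, hq, hqL⟩
      have hL : L.length + 1 = ν := by simpa [hqL] using hlen q
      have hk : L.length < ν := by omega
      have h := getElem?_labelledWord q hk
      simp [hqL] at h
      rw [h]
      refine ((hbound q hq).2 ⟨L.length, hk⟩ (by dsimp; omega)).trans ?_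
      exact Finset.single_le_sum (f := fun i => (pv i : ℤ))
        (fun i _ => Int.natCast_nonneg _) (Finset.mem_univ _))
    ν
  have hk' : (k : ℕ) < (labelledWord p).length := by simp [hlen]
  have hsplit : (labelledWord p).take k ++ (p.1 k, p.2 k) :: (labelledWord p).drop (k + 1) =
      labelledWord p := by
    have hget : (labelledWord p)[(k : ℕ)] = (p.1 k, p.2 k) := by simp [labelledWord]
    rw [← hget, List.getElem_cons_drop, List.take_append_drop]
  exact key _ (p.1 k, p.2 k) ((labelledWord p).drop (k + 1)) (by simp [hlen]) (by
    rw [hsplit]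
    exact ⟨p, .refl p, rfl⟩)

end Lusztig
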